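/- Let Ω ⊂ ℝ² be a bounded simply connected open set with smooth boundary, let μ₂(Ω) > 0 be the first nonzero Neumann eigenvalue of Ω, and let ψ be a corresponding eigenfunction (Δψ + μ₂(Ω)·ψ = 0 in Ω, ∂ψ/∂η = 0 on ∂Ω, ψ ≢ 0). Then ψ cannot have a closed nodal curve: there is no connected component Ω' of {x ∈ Ω : ψ(x) ≠ 0} whose closure is contained in Ω; equivalently, the closure of every nodal domain of ψ intersects ∂Ω. -/

import Mathlib

open Set MeasureTheory Metric Filter

noncomputable section

abbrev ESp (k : ℕ) : Type := EuclideanSpace ℝ (Fin k)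

/-- The Laplacian of a real-valued function on Euclidean space,
as the sum of the second derivatives along the coordinate directions. -/
def lap {k : ℕ} (f : ESp k → ℝ) (x : ESp k) : ℝ :=
  ∑ i : Fin k, fderiv ℝ (fun y => fderiv ℝ f y (EuclideanSpace.single i 1)) x
      (EuclideanSpace.single i 1)

/-- First Dirichlet eigenvalue as the infimum of the Rayleigh quotient over
nonzero smooth compactly supported test functions. -/
def dirEig1 {k : ℕ} (U : Set (ESp k)) : ℝ :=
  sInf { r : ℝ | ∃ u : ESp k → ℝ, ContDiff ℝ (⊤ : ℕ∞) u ∧ HasCompactSupport u ∧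
    tsupport u ⊆ U ∧ u ≠ 0 ∧
    r = (∫ x in U, ‖fderiv ℝ u x‖ ^ 2) / (∫ x in U, u x ^ 2) }

/-- First nonzero Neumann eigenvalue as the infimum of the Rayleigh quotient over
nonzero smooth mean-zero test functions. -/
def neuEig2 {k : ℕ} (U : Set (ESp k)) : ℝ :=
  sInf { r : ℝ | ∃ u : ESp k → ℝ, ContDiffOn ℝ (⊤ : ℕ∞) u (closure U) ∧
    (∃ x ∈ U, u x ≠ 0) ∧ (∫ x in U, u x) = 0 ∧
    r = (∫ x in U, ‖fderiv ℝ u x‖ ^ 2) / (∫ x in U, u x ^ 2) }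

/-- An eigenfunction of the first nonzero Neumann eigenvalue of `U`: nonzero, `C²` up to the
boundary, satisfying the Helmholtz equation in `U` and with vanishing derivative in the
direction of the outward unit normal (characterized geometrically) at each boundary point. -/
def IsNeuEigenfun2 {k : ℕ} (U : Set (ESp k)) (ψ : ESp k → ℝ) : Prop :=
  (∃ x ∈ U, ψ x ≠ 0) ∧ ContDiffOn ℝ 2 ψ (closure U) ∧
  (∀ x ∈ U, lap ψ x + neuEig2 U * ψ x = 0) ∧
  ∀ x ∈ frontier U, ∀ v : ESp k, ‖v‖ = 1 →
    (∀ᶠ t in nhdsWithin (0 : ℝ) (Set.Ioi 0), x + t • v ∉ closure U) →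
    (∀ᶠ t in nhdsWithin (0 : ℝ) (Set.Ioi 0), x - t • v ∈ U) →
    fderiv ℝ ψ x v = 0

/-- The partial derivative of `f` in the `i`-th coordinate direction. -/
def pderiv {k : ℕ} (i : Fin k) (f : ESp k → ℝ) (x : ESp k) : ℝ :=
  fderiv ℝ f x (EuclideanSpace.single i 1)

/-- The symmetric bilinear form `∫_U (∇f · ∇h - μ f h)`. -/
def energy {k : ℕ} (U : Set (ESp k)) (μ : ℝ) (f h : ESp k → ℝ) : ℝ :=
  ∫ x in U, (∑ i, pderiv i f x * pderiv i h x - μ * (f x * h x))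

lemma norm_fderiv_sq {k : ℕ} (f : ESp k → ℝ) (x : ESp k) :
    ‖fderiv ℝ f x‖ ^ 2 = ∑ i, pderiv i f x * pderiv i f x := by
  rw [(EuclideanSpace.basisFun (Fin k) ℝ).norm_dual]
  simp [pderiv, sq]

lemma integrableOn_of_continuous {k : ℕ} {U : Set (ESp k)} (hU : Bornology.IsBounded U)
    {f : ESp k → ℝ} (hf : Continuous f) : IntegrableOn f U :=
  (hf.continuousOn.integrableOn_compact hU.isCompact_closure).mono_set subset_closure

lemma continuous_pderiv {k : ℕ} {f : ESp k → ℝ} (hf : ContDiff ℝ 1 f) (i : Fin k) :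
    Continuous (pderiv i f) :=
  (hf.continuous_fderiv one_ne_zero).clm_apply continuous_const

lemma continuous_grad_mul_grad {k : ℕ} {f h : ESp k → ℝ}
    (hf : ContDiff ℝ 1 f) (hh : ContDiff ℝ 1 h) :
    Continuous fun x => ∑ i, pderiv i f x * pderiv i h x :=
  continuous_finsetSum _ fun i _ => (continuous_pderiv hf i).mul (continuous_pderiv hh i)

lemma continuous_energy_integrand {k : ℕ} (μ : ℝ) {f h : ESp k → ℝ}
    (hf : ContDiff ℝ 1 f) (hh : ContDiff ℝ 1 h) :
    Continuous fun x => ∑ i, pderiv i f x * pderiv i h x - μ * (f x * h x) :=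
  (continuous_grad_mul_grad hf hh).sub
    (continuous_const.mul (hf.continuous.mul hh.continuous))

lemma energy_self_eq {k : ℕ} (U : Set (ESp k)) (μ : ℝ) (f : ESp k → ℝ) :
    energy U μ f f = ∫ x in U, (‖fderiv ℝ f x‖ ^ 2 - μ * f x ^ 2) := by
  simp only [energy, norm_fderiv_sq, sq (f _)]

lemma energy_linear_combination {k : ℕ} {U : Set (ESp k)} (hU : Bornology.IsBounded U) (μ : ℝ)
    {f h : ESp k → ℝ} (hf : ContDiff ℝ 1 f) (hh : ContDiff ℝ 1 h) (a b : ℝ) :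
    energy U μ (fun x => a * f x + b * h x) (fun x => a * f x + b * h x) =
      a ^ 2 * energy U μ f f + 2 * a * b * energy U μ f h + b ^ 2 * energy U μ h h := by
  have hp : ∀ i x, pderiv i (fun x => a * f x + b * h x) x =
      a * pderiv i f x + b * pderiv i h x := by
    intro i x
    have h1 := hf.differentiable one_ne_zero x
    have h2 := hh.differentiable one_ne_zero x
    have := ((h1.hasFDerivAt.const_mul a).add (h2.hasFDerivAt.const_mul b)).fderiv
    simp only [pderiv]
    erw [this]
    simp
  have i1 := integrableOn_of_continuous hU (continuous_energy_integrand μ hf hf)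
  have i2 := integrableOn_of_continuous hU (continuous_energy_integrand μ hf hh)
  have i3 := integrableOn_of_continuous hU (continuous_energy_integrand μ hh hh)
  simp only [energy]
  have i12 := (i1.const_mul (a ^ 2)).add (i2.const_mul (2 * a * b))
  rw [← integral_const_mul, ← integral_const_mul, ← integral_const_mul,
    ← integral_add (i1.const_mul _) (i2.const_mul _)]
  erw [← integral_add i12 (i3.const_mul _)]
  congr 1
  ext x
  simp only [hp, mul_sub, Finset.mul_sum, Pi.add_apply]
  have : ∑ i, (a * pderiv i f x + b * pderiv i h x) * (a * pderiv i f x + b * pderiv i h x) =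
      ∑ i, a ^ 2 * (pderiv i f x * pderiv i f x) + ∑ i, 2 * a * b * (pderiv i f x * pderiv i h x)
      + ∑ i, b ^ 2 * (pderiv i h x * pderiv i h x) := by
    rw [← Finset.sum_add_distrib, ← Finset.sum_add_distrib]
    exact Finset.sum_congr rfl fun i _ => by ring
  rw [this]
  ring

lemma setIntegral_eq_integral_of_tsupport_subset {k : ℕ} {U : Set (ESp k)} {f : ESp k → ℝ}
    (g : ESp k → ℝ) (hf : tsupport f ⊆ U) (hg : ∀ x, x ∉ tsupport f → g x = 0) :
    ∫ x in U, g x = ∫ x, g x :=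
  setIntegral_eq_integral_of_forall_compl_eq_zero fun x hx => hg x fun h => hx (hf h)

lemma pderiv_eq_zero_of_notMem_tsupport {k : ℕ} {f : ESp k → ℝ} {x : ESp k}
    (hx : x ∉ tsupport f) (i : Fin k) : pderiv i f x = 0 := by
  have := fderiv_of_notMem_tsupport (𝕜 := ℝ) hx
  simp [pderiv, this]

/-- Green's identity for a compactly supported `C¹` function against a `C²` function. -/
lemma setIntegral_grad_mul_grad {k : ℕ} {U : Set (ESp k)} {f h : ESp k → ℝ}
    (hf : ContDiff ℝ 1 f) (hfc : HasCompactSupport f) (hfU : tsupport f ⊆ U)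
    (hh : ContDiff ℝ 2 h) :
    ∫ x in U, ∑ i, pderiv i f x * pderiv i h x = - ∫ x in U, f x * lap h x := by
  have hph : ∀ i : Fin k, ContDiff ℝ 1 (pderiv i h) := fun i =>
    (hh.fderiv_right (m := 1) (by norm_num)).clm_apply contDiff_const
  rw [setIntegral_eq_integral_of_tsupport_subset _ hfU
      (fun x hx => by simp [pderiv_eq_zero_of_notMem_tsupport hx]),
    setIntegral_eq_integral_of_tsupport_subset _ hfU
      (fun x hx => by simp [image_eq_zero_of_notMem_tsupport hx])]
  have c1 : ∀ i, Integrable fun x => pderiv i f x * pderiv i h x := fun i =>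
    ((continuous_pderiv hf i).mul (hph i).continuous).integrable_of_hasCompactSupport
      ((hfc.fderiv_apply (𝕜 := ℝ) _).mul_right)
  have c2 : ∀ i, Integrable fun x => f x * pderiv i (pderiv i h) x := fun i =>
    (hf.continuous.mul (continuous_pderiv (hph i) i)).integrable_of_hasCompactSupport
      hfc.mul_right
  have c3 : ∀ i, Integrable fun x => f x * pderiv i h x := fun i =>
    (hf.continuous.mul (hph i).continuous).integrable_of_hasCompactSupport
      hfc.mul_right
  have key : ∀ i, ∫ x, f x * pderiv i (pderiv i h) x = - ∫ x, pderiv i f x * pderiv i h x :=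
    fun i => integral_mul_fderiv_eq_neg_fderiv_mul_of_integrable (c1 i) (c2 i) (c3 i)
      (fun x _ => hf.differentiable one_ne_zero x)
      (fun x _ => (hph i).differentiable one_ne_zero x)
  have hl : ∀ x, f x * lap h x = ∑ i, f x * pderiv i (pderiv i h) x := by
    intro x
    rw [← Finset.mul_sum]
    rfl
  simp only [hl]
  rw [integral_finsetSum _ fun i _ => c1 i, integral_finsetSum _ fun i _ => c2 i]
  simp [key]

/-- Mollification in `C¹` norm of a compactly supported `C¹` function, keeping its support
inside a given open set. -/
lemma exists_contDiff_approx {k : ℕ} {U : Set (ESp k)} (hU : IsOpen U) {f : ESp k → ℝ}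
    (hf : ContDiff ℝ 1 f) (hfc : HasCompactSupport f) (hfU : tsupport f ⊆ U)
    {η : ℝ} (hη : 0 < η) :
    ∃ g : ESp k → ℝ, ContDiff ℝ (⊤ : ℕ∞) g ∧ HasCompactSupport g ∧ tsupport g ⊆ U ∧
      ∀ x, |g x - f x| ≤ η ∧ ‖fderiv ℝ g x - fderiv ℝ f x‖ ≤ η := by
  obtain ⟨δ, hδ, hδU⟩ := hfc.isCompact.exists_cthickening_subset_open hU hfU
  have hf' := hf.continuous_fderiv one_ne_zero
  have u1 := hfc.uniformContinuous_of_continuous hf.continuous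
  have u2 := (hfc.fderiv (𝕜 := ℝ)).uniformContinuous_of_continuous hf'
  obtain ⟨δ₁, hδ₁, h1⟩ := Metric.uniformContinuous_iff.mp u1 η hη
  obtain ⟨δ₂, hδ₂, h2⟩ := Metric.uniformContinuous_iff.mp u2 η hη
  set r := min δ (min δ₁ δ₂) with hr
  have hr0 : 0 < r := lt_min hδ (lt_min hδ₁ hδ₂)
  set φ : ContDiffBump (0 : ESp k) := ⟨r / 2, r, half_pos hr0, half_lt_self hr0⟩ with hφ
  set g : ESp k → ℝ :=
    convolution (φ.normed volume) f (ContinuousLinearMap.lsmul ℝ ℝ) volume with hg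
  have hgf : ∀ x (e : ℝ), (∀ y ∈ ball x r, dist (f y) (f x) ≤ e) → dist (g x) (f x) ≤ e :=
    fun x e h => φ.dist_normed_convolution_le hf.continuous.aestronglyMeasurable h
  have hgd : ∀ x, fderiv ℝ g x =
      convolution (φ.normed volume) (fderiv ℝ f) (ContinuousLinearMap.lsmul ℝ ℝ) volume x := by
    intro x
    rw [(hfc.hasFDerivAt_convolution_right (ContinuousLinearMap.lsmul ℝ ℝ)
      (φ.continuous_normed.locallyIntegrable) hf x).fderiv]
    rfl
  have hsupp : tsupport g ⊆ cthickening δ (tsupport f) := by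
    refine closure_minimal (fun x hx => ?_) isClosed_cthickening
    by_contra hxn
    refine hx ?_
    have hz : ∀ y ∈ ball x r, f y = 0 := by
      intro y hy
      by_contra hne
      refine hxn (mem_cthickening_of_dist_le x y δ _ (subset_tsupport f hne) ?_)
      rw [dist_comm]
      exact (mem_ball.mp hy).le.trans (min_le_left _ _)
    have h0 := hz x (mem_ball_self hr0)
    have := hgf x 0 fun y hy => by simp [hz y hy, h0]
    rw [h0] at this
    exact dist_le_zero.mp this
  refine ⟨g, ?_, ?_, hsupp.trans hδU, fun x => ⟨?_, ?_⟩⟩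
  · exact φ.hasCompactSupport_normed.contDiff_convolution_left _ φ.contDiff_normed
      hf.continuous.locallyIntegrable
  · exact HasCompactSupport.of_support_subset_isCompact hfc.isCompact.cthickening
      ((subset_tsupport g).trans hsupp)
  · rw [← Real.dist_eq]
    exact hgf x η fun y hy =>
      (h1 ((mem_ball.mp hy).trans_le ((min_le_right _ _).trans (min_le_left _ _)))).le
  · rw [hgd, ← dist_eq_norm]
    exact φ.dist_normed_convolution_le hf'.aestronglyMeasurable fun y hy =>
      (h2 ((mem_ball.mp hy).trans_le ((min_le_right _ _).trans (min_le_right _ _)))).le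

/-- Negativity of the energy survives smoothing. -/
lemma exists_contDiff_energy_neg {k : ℕ} {U : Set (ESp k)} (hU : IsOpen U)
    (hb : Bornology.IsBounded U) {μ : ℝ} (hμ : 0 < μ) {f : ESp k → ℝ}
    (hf : ContDiff ℝ 1 f) (hfc : HasCompactSupport f) (hfU : tsupport f ⊆ U)
    (hneg : energy U μ f f < 0) :
    ∃ g : ESp k → ℝ, ContDiff ℝ (⊤ : ℕ∞) g ∧ HasCompactSupport g ∧ tsupport g ⊆ U ∧
      energy U μ g g < 0 := by
  have hf' := hf.continuous_fderiv one_ne_zero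
  set C := ∫ x in U, (2 * ‖fderiv ℝ f x‖ + 1 + 2 * μ * |f x|) with hC
  have hC0 : 0 ≤ C := integral_nonneg fun x => by positivity
  set E := energy U μ f f with hE
  obtain ⟨η, hη, hη1, hηC⟩ : ∃ η : ℝ, 0 < η ∧ η ≤ 1 ∧ E + η * C < 0 := by
    refine ⟨min 1 (-E / (C + 1)), lt_min one_pos (div_pos (by linarith) (by linarith)),
      min_le_left _ _, ?_⟩
    have h1 : min 1 (-E / (C + 1)) * C ≤ -E / (C + 1) * C :=
      mul_le_mul_of_nonneg_right (min_le_right _ _) hC0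
    have h2 : -E / (C + 1) * C < -E := by
      rw [div_mul_eq_mul_div, div_lt_iff₀ (by linarith)]
      nlinarith
    linarith
  obtain ⟨g, hg, hgc, hgU, hgf⟩ := exists_contDiff_approx hU hf hfc hfU hη
  refine ⟨g, hg, hgc, hgU, ?_⟩
  have hg1 : ContDiff ℝ 1 g := hg.of_le (by exact_mod_cast le_top)
  have hg' := hg1.continuous_fderiv one_ne_zero
  have hgcont := hg1.continuous
  have hfcont := hf.continuous
  refine lt_of_le_of_lt ?_ hηC
  rw [hE, hC, energy_self_eq, energy_self_eq, ← integral_const_mul, ← integral_add]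
  · refine integral_mono (integrableOn_of_continuous hb (by fun_prop))
      (integrableOn_of_continuous hb (by fun_prop)) fun x => ?_
    obtain ⟨h1, h2⟩ := hgf x
    have h3 : ‖fderiv ℝ g x‖ ≤ ‖fderiv ℝ f x‖ + η := by
      have := norm_sub_norm_le (fderiv ℝ g x) (fderiv ℝ f x)
      linarith
    have h4 : ‖fderiv ℝ g x‖ ^ 2 ≤ (‖fderiv ℝ f x‖ + η) ^ 2 :=
      pow_le_pow_left₀ (norm_nonneg _) h3 2
    have h5 : f x ^ 2 - 2 * η * |f x| ≤ g x ^ 2 := by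
      have h6 : |g x| ≥ |f x| - η := by
        have := abs_sub_abs_le_abs_sub (f x) (g x)
        rw [abs_sub_comm] at this
        linarith
      rw [← sq_abs (f x), ← sq_abs (g x)]
      nlinarith [sq_nonneg (|g x| - |f x|), abs_nonneg (f x)]
    have h7 : η ^ 2 ≤ η := by nlinarith
    have h8 := mul_le_mul_of_nonneg_left h5 hμ.le
    simp only
    nlinarith
  · exact integrableOn_of_continuous hb (by fun_prop)
  · exact integrableOn_of_continuous hb (by fun_prop)

/-- A plane wave in the first coordinate direction of the plane. -/
def planeWave (κ θ : ℝ) (x : ESp 2) : ℝ := Real.cos (κ * x 0 + θ)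

lemma contDiff_planeWave (κ θ : ℝ) {n : WithTop ℕ∞} : ContDiff ℝ n (planeWave κ θ) := by
  unfold planeWave
  fun_prop

lemma planeWave_quarter (κ θ : ℝ) (x : ESp 2) :
    planeWave κ (θ + Real.pi / 2) x = -Real.sin (κ * x 0 + θ) := by
  rw [planeWave, ← add_assoc, Real.cos_add_pi_div_two]

lemma planeWave_half (κ θ : ℝ) (x : ESp 2) :
    planeWave κ (θ + Real.pi / 2 + Real.pi / 2) x = -planeWave κ θ x := by
  rw [planeWave, planeWave, ← Real.cos_add_pi]
  congr 1
  ring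

lemma pderiv_planeWave (κ θ : ℝ) (i : Fin 2) (x : ESp 2) :
    pderiv i (planeWave κ θ) x =
      if i = 0 then κ * planeWave κ (θ + Real.pi / 2) x else 0 := by
  have h0 : HasFDerivAt (fun y : ESp 2 => κ * y 0 + θ)
      (κ • (EuclideanSpace.proj 0 : ESp 2 →L[ℝ] ℝ)) x :=
    ((EuclideanSpace.proj 0 : ESp 2 →L[ℝ] ℝ).hasFDerivAt.const_mul κ).add_const θ
  have h1 : fderiv ℝ (planeWave κ θ) x = _ := h0.cos.fderiv
  rw [pderiv, h1, planeWave_quarter]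
  fin_cases i <;> simp [mul_comm]

lemma lap_planeWave (κ θ : ℝ) (x : ESp 2) :
    lap (planeWave κ θ) x = -(κ ^ 2 * planeWave κ θ x) := by
  have h0 : lap (planeWave κ θ) x = ∑ i, pderiv i (pderiv i (planeWave κ θ)) x := rfl
  have h1 : pderiv 0 (planeWave κ θ) = fun y => κ * planeWave κ (θ + Real.pi / 2) y := by
    ext y
    simp [pderiv_planeWave]
  have h2 : pderiv 1 (planeWave κ θ) = fun _ => 0 := by
    ext y
    simp [pderiv_planeWave]
  have h3 : pderiv 0 (fun y => κ * planeWave κ (θ + Real.pi / 2) y) x =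
      κ * pderiv 0 (planeWave κ (θ + Real.pi / 2)) x := by
    rw [pderiv, fderiv_const_mul ((contDiff_planeWave κ _ (n := 1)).differentiable one_ne_zero x)]
    rfl
  rw [h0, Fin.sum_univ_two, h1, h2, h3, pderiv_planeWave, if_pos rfl, planeWave_half]
  simp [pderiv]
  ring

lemma abs_planeWave_le_one (κ θ : ℝ) (x : ESp 2) : |planeWave κ θ x| ≤ 1 :=
  Real.abs_cos_le_one _

/-- For a frequency `κ`, one of the two plane waves in quadrature has energy at most
half of `(κ² - μ) |U|`. -/
lemma exists_planeWave_energy_le {U : Set (ESp 2)} (hb : Bornology.IsBounded U) (μ κ : ℝ) :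
    ∃ θ, 2 * energy U μ (planeWave κ θ) (planeWave κ θ) ≤ (κ ^ 2 - μ) * volume.real U := by
  have hsum : energy U μ (planeWave κ 0) (planeWave κ 0) +
      energy U μ (planeWave κ (0 + Real.pi / 2)) (planeWave κ (0 + Real.pi / 2)) =
      (κ ^ 2 - μ) * volume.real U := by
    have hc : ∀ θ, ContDiff ℝ 1 (planeWave κ θ) := fun θ => contDiff_planeWave κ θ
    unfold energy
    rw [← integral_add
      (integrableOn_of_continuous hb (continuous_energy_integrand μ (hc _) (hc _)))
      (integrableOn_of_continuous hb (continuous_energy_integrand μ (hc _) (hc _))),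
      mul_comm, ← smul_eq_mul (volume.real U), ← setIntegral_const]
    congr 1
    ext x
    simp only [Fin.sum_univ_two, pderiv_planeWave, planeWave_half, if_true, one_ne_zero, if_false]
    rw [planeWave_quarter, planeWave]
    linear_combination (κ ^ 2 - μ) * Real.sin_sq_add_cos_sq (κ * x 0 + 0)
  by_contra! h
  linarith [h 0, h (0 + Real.pi / 2)]

lemma energy_planeWave_right {U : Set (ESp 2)} (hb : Bornology.IsBounded U) (μ κ θ : ℝ)
    {f : ESp 2 → ℝ} (hf : ContDiff ℝ 1 f) (hfc : HasCompactSupport f) (hfU : tsupport f ⊆ U) :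
    energy U μ f (planeWave κ θ) = (κ ^ 2 - μ) * ∫ x in U, f x * planeWave κ θ x := by
  have hc : ContDiff ℝ 1 (planeWave κ θ) := contDiff_planeWave κ θ
  have h := setIntegral_grad_mul_grad hf hfc hfU (contDiff_planeWave κ θ)
  have hI : IntegrableOn (fun x => f x * planeWave κ θ x) U :=
    integrableOn_of_continuous hb (hf.continuous.mul hc.continuous)
  unfold energy
  rw [integral_sub (integrableOn_of_continuous hb (continuous_grad_mul_grad hf hc)) (hI.const_mul μ), h,
    ← integral_neg, integral_const_mul, sub_mul, ← integral_const_mul (κ ^ 2)]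
  congr 2
  ext x
  rw [lap_planeWave]
  ring

/-- A Pólya-type inequality: if the Dirichlet form has a negative direction, then so does the
Neumann form on functions of mean zero. -/
lemma exists_mean_zero_energy_neg {U : Set (ESp 2)} (hU : IsOpen U) (hne : U.Nonempty)
    (hb : Bornology.IsBounded U) {μ : ℝ} (hμ : 0 < μ) {f : ESp 2 → ℝ}
    (hf : ContDiff ℝ (⊤ : ℕ∞) f) (hfc : HasCompactSupport f) (hfU : tsupport f ⊆ U)
    (hneg : energy U μ f f < 0) :
    ∃ v : ESp 2 → ℝ, ContDiff ℝ (⊤ : ℕ∞) v ∧ ∫ x in U, v x = 0 ∧ energy U μ v v < 0 := by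
  have hf1 : ContDiff ℝ 1 f := hf.of_le (by exact_mod_cast le_top)
  set A := -energy U μ f f with hA
  have hA0 : 0 < A := by linarith
  set B := ∫ x in U, |f x| with hB
  have hB0 : 0 ≤ B := integral_nonneg fun x => abs_nonneg _
  set V := volume.real U with hV
  have hV0 : 0 < V := ENNReal.toReal_pos (hU.measure_pos volume hne).ne' hb.measure_lt_top.ne
  obtain ⟨δ, hδ, hδμ, hδB⟩ : ∃ δ : ℝ, 0 < δ ∧ δ ≤ μ ∧ 2 * δ * B ^ 2 < A * V := by
    refine ⟨min μ (A * V / (2 * B ^ 2 + 1)), lt_min hμ (by positivity), min_le_left _ _, ?_⟩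
    have h1 : min μ (A * V / (2 * B ^ 2 + 1)) * (2 * B ^ 2 + 1) ≤ A * V :=
      (le_div_iff₀ (by positivity)).mp (min_le_right _ _)
    have h2 : 0 < min μ (A * V / (2 * B ^ 2 + 1)) := lt_min hμ (by positivity)
    linarith
  have hκ : Real.sqrt (μ - δ) ^ 2 - μ = -δ := by
    rw [Real.sq_sqrt (by linarith)]
    ring
  obtain ⟨θ, hθ⟩ := exists_planeWave_energy_le hb μ (Real.sqrt (μ - δ))
  have hX := energy_planeWave_right hb μ (Real.sqrt (μ - δ)) θ hf1 hfc hfU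
  rw [hκ] at hθ hX
  set c := planeWave (Real.sqrt (μ - δ)) θ with hc
  have hcs : ContDiff ℝ (⊤ : ℕ∞) c := contDiff_planeWave _ _
  have hc1 : ContDiff ℝ 1 c := contDiff_planeWave _ _
  set I := ∫ x in U, f x * c x with hI
  have hIB : |I| ≤ B := by
    refine (abs_integral_le_integral_abs).trans
      (integral_mono (integrableOn_of_continuous hb ?_) (integrableOn_of_continuous hb ?_) ?_)
    · exact (hf1.continuous.mul hc1.continuous).abs
    · exact hf1.continuous.abs
    · intro x
      simp only [abs_mul]
      exact mul_le_of_le_one_right (abs_nonneg _) (abs_planeWave_le_one _ _ _)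
  have hI2 : I ^ 2 ≤ B ^ 2 := sq_le_sq.mpr (by rwa [abs_of_nonneg hB0])
  obtain ⟨a, b, hab, hmean⟩ : ∃ a b : ℝ, (a ≠ 0 ∨ b ≠ 0) ∧
      a * (∫ x in U, f x) + b * (∫ x in U, c x) = 0 := by
    by_cases h : ∫ x in U, f x = 0
    · exact ⟨1, 0, Or.inl one_ne_zero, by simp [h]⟩
    · exact ⟨-∫ x in U, c x, ∫ x in U, f x, Or.inr h, by ring⟩
  refine ⟨fun x => a * f x + b * c x,
    (contDiff_const.mul hf).add (contDiff_const.mul hcs), ?_, ?_⟩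
  · rw [integral_add ((integrableOn_of_continuous hb hf1.continuous).const_mul a)
      ((integrableOn_of_continuous hb hc1.continuous).const_mul b), integral_const_mul,
      integral_const_mul, hmean]
  · rw [energy_linear_combination hb μ hf1 hc1, hX]
    have e1 : energy U μ f f = -A := by rw [hA, neg_neg]
    rw [e1]
    have e2 : b ^ 2 * energy U μ c c ≤ b ^ 2 * (-δ * V / 2) :=
      mul_le_mul_of_nonneg_left (by linarith) (sq_nonneg b)
    have e3 : 2 * δ * I ^ 2 < A * V :=
      lt_of_le_of_lt (mul_le_mul_of_nonneg_left hI2 (by positivity)) hδB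
    -- complete the square in `a`, after multiplication by `A`
    have e4 : 0 < A * (A * a ^ 2 + 2 * a * b * (δ * I) + b ^ 2 * (δ * V / 2)) := by
      have : A * (A * a ^ 2 + 2 * a * b * (δ * I) + b ^ 2 * (δ * V / 2)) =
          (A * a + b * δ * I) ^ 2 + b ^ 2 * (δ / 2 * (A * V - 2 * δ * I ^ 2)) := by ring
      rw [this]
      have hpos : 0 < δ / 2 * (A * V - 2 * δ * I ^ 2) := mul_pos (by linarith) (by linarith)
      by_cases hb0 : b = 0
      · have ha0 : a ≠ 0 := hab.resolve_right (not_not.mpr hb0)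
        subst hb0
        have : A * a ≠ 0 := mul_ne_zero hA0.ne' ha0
        simp only [zero_mul, add_zero, ne_eq, OfNat.ofNat_ne_zero, not_false_eq_true, zero_pow]
        positivity
      · have : 0 < b ^ 2 * (δ / 2 * (A * V - 2 * δ * I ^ 2)) := by positivity
        nlinarith [sq_nonneg (A * a + b * δ * I)]
    have e5 := pos_of_mul_pos_right e4 hA0.le
    nlinarith

lemma not_energy_neg_of_mean_zero {k : ℕ} {U : Set (ESp k)} (hb : Bornology.IsBounded U)
    {v : ESp k → ℝ} (hv : ContDiff ℝ (⊤ : ℕ∞) v) (hmean : ∫ x in U, v x = 0)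
    (hμ : 0 < neuEig2 U) : ¬ energy U (neuEig2 U) v v < 0 := by
  intro hneg
  have hv1 : ContDiff ℝ 1 v := hv.of_le (by exact_mod_cast le_top)
  have hvc := hv1.continuous
  have hvd := hv1.continuous_fderiv one_ne_zero
  rw [energy_self_eq, integral_sub (integrableOn_of_continuous hb (by fun_prop))
    (integrableOn_of_continuous hb (by fun_prop)), integral_const_mul] at hneg
  have h1 : 0 ≤ ∫ x in U, ‖fderiv ℝ v x‖ ^ 2 := integral_nonneg fun x => by positivity
  have h2 : 0 < ∫ x in U, v x ^ 2 := pos_of_mul_pos_right (by linarith) hμ.le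
  have h3 : ∃ x ∈ U, v x ≠ 0 := by
    by_contra! h
    exact h2.ne' (setIntegral_eq_zero_of_forall_eq_zero fun x hx => by simp [h x hx])
  have h4 : neuEig2 U ≤ (∫ x in U, ‖fderiv ℝ v x‖ ^ 2) / (∫ x in U, v x ^ 2) := by
    refine csInf_le ⟨0, ?_⟩ ⟨v, hv.contDiffOn, h3, hmean, rfl⟩
    rintro r ⟨u, -, -, -, rfl⟩
    exact div_nonneg (integral_nonneg fun x => by positivity)
      (integral_nonneg fun x => by positivity)
  rw [le_div_iff₀ h2] at h4
  linarith

/-- A `C¹` truncation of the positive part: it vanishes below the level `ε`,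
has slope in `[0, 1]`, and is `2ε`-close to the identity on the positive axis. -/
lemma exists_truncation {ε : ℝ} (hε : 0 < ε) :
    ∃ G g : ℝ → ℝ, Continuous g ∧ (∀ t, HasDerivAt G (g t) t) ∧ (∀ t, 0 ≤ g t ∧ g t ≤ 1) ∧
      (∀ t ≤ ε, G t = 0) ∧ ∀ t, 0 ≤ t → 0 ≤ G t ∧ t - 2 * ε ≤ G t := by
  set g : ℝ → ℝ := fun s => max 0 (min 1 (s / ε - 1)) with hg
  have hgc : Continuous g := by
    simp only [hg]
    fun_prop
  have hg0 : ∀ s, 0 ≤ g s := fun s => le_max_left _ _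
  have hi : ∀ a b, IntervalIntegrable g volume a b := fun a b => hgc.intervalIntegrable a b
  have hnn : ∀ t, 0 ≤ t → 0 ≤ ∫ s in (0 : ℝ)..t, g s := fun t ht =>
    intervalIntegral.integral_nonneg ht fun s _ => hg0 s
  refine ⟨fun t => ∫ s in (0 : ℝ)..t, g s, g, hgc,
    fun t => intervalIntegral.integral_hasDerivAt_right (hi 0 t)
      (hgc.stronglyMeasurableAtFilter _ _) hgc.continuousAt,
    fun t => ⟨hg0 t, max_le zero_le_one (min_le_left _ _)⟩, fun t ht => ?_, fun t ht =>
      ⟨hnn t ht, ?_⟩⟩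
  · have : ∀ s ∈ uIcc 0 t, g s = 0 := by
      intro s hs
      have hs' : s ≤ ε := hs.2.trans (max_le hε.le ht)
      refine max_eq_left ((min_le_right _ _).trans ?_)
      rw [sub_nonpos, div_le_one hε]
      exact hs'
    simp only
    rw [intervalIntegral.integral_congr this]
    simp
  · rcases le_total t (2 * ε) with h | h
    · linarith [hnn t ht]
    · have h1 := intervalIntegral.integral_add_adjacent_intervals (hi 0 (2 * ε)) (hi (2 * ε) t)
      have h2 : ∫ s in (2 * ε)..t, g s = t - 2 * ε := by
        have : ∀ s ∈ uIcc (2 * ε) t, g s = 1 := by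
          intro s hs
          rw [uIcc_of_le h] at hs
          have : 1 ≤ s / ε - 1 := by
            rw [le_sub_iff_add_le, le_div_iff₀ hε]
            linarith [hs.1]
          simp [hg, min_eq_left this]
        rw [intervalIntegral.integral_congr this]
        simp
      simp only
      linarith [hnn (2 * ε) (by linarith)]

/-- A positive solution of `Δφ + μφ = 0` on a nodal domain `N` compactly contained in `U`
produces a compactly supported `C¹` function in `U` with negative energy. -/
lemma exists_energy_neg_of_nodal_domain {k : ℕ} {U N : Set (ESp k)}
    (hb : Bornology.IsBounded U) {μ : ℝ} (hμ : 0 < μ)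
    (hN : IsOpen N) (hNne : N.Nonempty) (hNU : closure N ⊆ U) {φ χ : ESp k → ℝ}
    (hφ : ContDiff ℝ 2 φ) (hpos : ∀ x ∈ N, 0 < φ x) (hzero : ∀ x ∈ frontier N, φ x = 0)
    (heq : ∀ x ∈ N, lap φ x = -(μ * φ x))
    (hχ : ContDiff ℝ 1 χ) (hχc : HasCompactSupport χ) (hχU : tsupport χ ⊆ U)
    (hχN : ∀ x ∈ N, χ x = 1) :
    ∃ f : ESp k → ℝ, ContDiff ℝ 1 f ∧ HasCompactSupport f ∧ tsupport f ⊆ U ∧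
      energy U μ f f < 0 := by
  have hNU' : N ⊆ U := subset_closure.trans hNU
  have hφ1 : ContDiff ℝ 1 φ := hφ.of_le (by norm_num)
  have hNb : Bornology.IsBounded N := hb.subset hNU'
  have hφN : IntegrableOn φ N := integrableOn_of_continuous hNb hφ.continuous
  set P := ∫ x in N, φ x with hP
  have hP0 : 0 < P := by
    rw [hP, setIntegral_pos_iff_support_of_nonneg_ae
      ((ae_restrict_mem hN.measurableSet).mono fun x hx => (hpos x hx).le) hφN]
    rw [inter_eq_right.mpr fun x hx => Function.mem_support.mpr (hpos x hx).ne']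
    exact hN.measure_pos volume hNne
  set V := volume.real N with hV
  have hV0 : 0 ≤ V := measureReal_nonneg
  set E := energy U μ χ χ with hE
  obtain ⟨ε, hε, hεP⟩ : ∃ ε : ℝ, 0 < ε ∧ 2 * ε * (μ * V + |E|) < μ * P := by
    refine ⟨μ * P / (2 * (μ * V + |E| + 1)), by positivity, ?_⟩
    rw [mul_div_assoc', div_mul_eq_mul_div, div_lt_iff₀ (by positivity)]
    nlinarith [mul_pos hμ hP0]
  obtain ⟨G, g, hgc, hG, hg01, hG0, hGt⟩ := exists_truncation hε
  set w := N.indicator fun x => G (φ x) with hw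
  have hGd : ∀ x, HasFDerivAt (fun x => G (φ x)) (g (φ x) • fderiv ℝ φ x) x := fun x =>
    (hG (φ x)).comp_hasFDerivAt x (hφ1.differentiable one_ne_zero x).hasFDerivAt
  have hG1 : ContDiff ℝ 1 fun x => G (φ x) := by
    refine ContDiff.comp (contDiff_one_iff_deriv.mpr ⟨fun t => (hG t).differentiableAt, ?_⟩) hφ1
    rwa [funext fun t => (hG t).deriv]
  have hwN : ∀ x ∈ N, w =ᶠ[nhds x] fun x => G (φ x) := fun x hx => by
    filter_upwards [hN.mem_nhds hx] with y hy
    exact indicator_of_mem hy _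
  have hwN' : ∀ x, x ∉ N → w =ᶠ[nhds x] 0 := fun x hx => by
    by_cases hxc : x ∈ closure N
    · have hxf : φ x = 0 := hzero x ⟨hxc, by rwa [hN.interior_eq]⟩
      have : ∀ᶠ y in nhds x, φ y < ε :=
        hφ.continuous.continuousAt.eventually_lt_const (by rwa [hxf])
      filter_upwards [this] with y hy
      simp only [hw, indicator, Pi.zero_apply]
      split_ifs
      · exact hG0 _ hy.le
      · rfl
    · filter_upwards [isClosed_closure.isOpen_compl.mem_nhds hxc] with y hy
      exact indicator_of_notMem (fun h => hy (subset_closure h)) _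
  have hw1 : ContDiff ℝ 1 w := contDiff_iff_contDiffAt.mpr fun x => by
    by_cases hx : x ∈ N
    · exact hG1.contDiffAt.congr_of_eventuallyEq (hwN x hx)
    · exact contDiffAt_const.congr_of_eventuallyEq (hwN' x hx)
  have hwsupp : tsupport w ⊆ N := fun x hx => by
    by_contra h
    exact notMem_tsupport_iff_eventuallyEq.mpr (hwN' x h) hx
  have hwc : HasCompactSupport w := HasCompactSupport.of_support_subset_isCompact
    hNb.isCompact_closure ((subset_tsupport w).trans (hwsupp.trans subset_closure))
  have hw0 : ∀ x, x ∉ N → w x = 0 := fun x hx => indicator_of_notMem hx _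
  have hwp0 : ∀ i x, x ∉ N → pderiv i w x = 0 := fun i x hx =>
    pderiv_eq_zero_of_notMem_tsupport (fun h => hx (hwsupp h)) i
  have hwp : ∀ i, ∀ x ∈ N, pderiv i w x = g (φ x) * pderiv i φ x := fun i x hx => by
    rw [pderiv, (hwN x hx).fderiv_eq, (hGd x).fderiv]
    rfl
  set W := ∫ x in U, w x with hW
  have hWP : P - 2 * ε * V ≤ W := by
    have h1 : W = ∫ x in N, G (φ x) := by
      rw [hW, setIntegral_indicator hN.measurableSet, inter_eq_right.mpr hNU']
    have h2 : ∫ x in N, (φ x - 2 * ε) = P - 2 * ε * V := by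
      rw [integral_sub hφN (integrableOn_of_continuous hNb continuous_const), setIntegral_const,
        smul_eq_mul, mul_comm]
    rw [h1, ← h2]
    exact setIntegral_mono_on (integrableOn_of_continuous hNb (hφ.continuous.sub continuous_const))
      (integrableOn_of_continuous hNb hG1.continuous) hN.measurableSet
      fun x hx => (hGt _ (hpos x hx).le).2
  have hQw : energy U μ w w ≤ 2 * ε * μ * W := by
    have hgreen := setIntegral_grad_mul_grad hw1 hwc (hwsupp.trans hNU') hφ
    have h1 : energy U μ w w ≤ ∫ x in U, (∑ i, pderiv i w x * pderiv i φ x - μ * (w x * w x)) := by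
      refine integral_mono (integrableOn_of_continuous hb (continuous_energy_integrand μ hw1 hw1))
        (integrableOn_of_continuous hb ((continuous_grad_mul_grad hw1 hφ1).sub
          (continuous_const.mul (hw1.continuous.mul hw1.continuous)))) fun x => ?_
      refine sub_le_sub_right (Finset.sum_le_sum fun i _ => ?_) _
      by_cases hx : x ∈ N
      · rw [hwp i x hx]
        obtain ⟨h0, h1⟩ := hg01 (φ x)
        nlinarith [mul_nonneg (mul_nonneg h0 (sub_nonneg.mpr h1)) (mul_self_nonneg (pderiv i φ x))]
      · simp [hwp0 i x hx]
    have h2 : ∫ x in U, w x * lap φ x = ∫ x in U, -(μ * (w x * φ x)) := by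
      congr 1
      ext x
      by_cases hx : x ∈ N
      · rw [heq x hx]
        ring
      · simp [hw0 x hx]
    have hwφ : IntegrableOn (fun x => μ * (w x * φ x)) U :=
      integrableOn_of_continuous hb
        (continuous_const.mul (hw1.continuous.mul hφ1.continuous))
    have hww : IntegrableOn (fun x => μ * (w x * w x)) U :=
      integrableOn_of_continuous hb
        (continuous_const.mul (hw1.continuous.mul hw1.continuous))
    rw [integral_sub (integrableOn_of_continuous hb (continuous_grad_mul_grad hw1 hφ1)) hww,
      hgreen, h2, integral_neg, neg_neg, ← integral_sub hwφ hww] at h1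
    refine h1.trans ?_
    rw [hW, ← integral_const_mul]
    refine integral_mono (hwφ.sub hww)
      (integrableOn_of_continuous hb (continuous_const.mul hw1.continuous)) fun x => ?_
    by_cases hx : x ∈ N
    · have h3 : w x = G (φ x) := indicator_of_mem hx _
      obtain ⟨h4, h5⟩ := hGt _ (hpos x hx).le
      rw [← h3] at h4 h5
      have h6 : 0 ≤ μ * w x := mul_nonneg hμ.le h4
      simp only
      nlinarith
    · simp [hw0 x hx]
  have hwχ : energy U μ w χ = -(μ * W) := by
    rw [hW, ← integral_const_mul, ← integral_neg]
    unfold energy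
    congr 1
    ext x
    by_cases hx : x ∈ N
    · have hχ1 : χ =ᶠ[nhds x] fun _ => 1 := by
        filter_upwards [hN.mem_nhds hx] with y hy using hχN y hy
      have : ∀ i, pderiv i χ x = 0 := fun i => by
        rw [pderiv, hχ1.fderiv_eq]
        simp
      simp [this, hχN x hx]
    · simp [hw0 x hx, hwp0 _ x hx]
  refine ⟨fun x => 1 * w x + 2 * ε * χ x, (contDiff_const.mul hw1).add (contDiff_const.mul hχ),
    (hwc.mul_left).add (hχc.mul_left), ?_, ?_⟩
  · refine (tsupport_add _ _).trans (union_subset ?_ ?_)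
    · exact (tsupport_mul_subset_right).trans (hwsupp.trans hNU')
    · exact (tsupport_mul_subset_right).trans hχU
  · rw [energy_linear_combination hb μ hw1 hχ, hwχ, ← hE]
    have h1 : E ≤ |E| := le_abs_self E
    have h2 : 0 < μ * W - 2 * ε * E := by nlinarith
    nlinarith

lemma exists_smooth_cutoff {k : ℕ} {U K : Set (ESp k)} (hU : IsOpen U)
    (hb : Bornology.IsBounded U) (hK : IsClosed K) (hKU : K ⊆ U) :
    ∃ χ : ESp k → ℝ, ContDiff ℝ (⊤ : ℕ∞) χ ∧ HasCompactSupport χ ∧ tsupport χ ⊆ U ∧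
      ∀ᶠ x in nhdsSet K, χ x = 1 := by
  obtain ⟨χ, h0, h1, -⟩ := exists_contMDiffMap_zero_one_nhds_of_isClosed
    (n := (⊤ : ℕ∞)) (modelWithCornersSelf ℝ (ESp k)) hU.isClosed_compl hK
    (disjoint_compl_left_iff_subset.mpr hKU)
  have hs : tsupport χ ⊆ U := fun x hx => by
    by_contra h
    exact notMem_tsupport_iff_eventuallyEq.mpr (eventually_nhdsSet_iff_forall.mp h0 x h) hx
  exact ⟨χ, χ.contMDiff.contDiff, HasCompactSupport.of_support_subset_isCompact
    hb.isCompact_closure ((subset_tsupport _).trans (hs.trans subset_closure)), hs, h1⟩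

lemma eq_zero_of_mem_frontier_nodal_domain {k : ℕ} {U : Set (ESp k)} {ψ : ESp k → ℝ} {x y : ESp k}
    (hS : IsOpen {z ∈ U | ψ z ≠ 0}) (hyU : y ∈ U)
    (hy : y ∈ frontier (connectedComponentIn {z ∈ U | ψ z ≠ 0} x)) : ψ y = 0 := by
  by_contra hne
  have hyS : y ∈ {z ∈ U | ψ z ≠ 0} := ⟨hyU, hne⟩
  have hopen := hS.connectedComponentIn (x := y)
  obtain ⟨z, hz, hz'⟩ := mem_closure_iff.mp hy.1 _ hopen (mem_connectedComponentIn hyS)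
  have h := (connectedComponentIn_eq hz).trans (connectedComponentIn_eq hz').symm
  refine hy.2 ?_
  rw [(hS.connectedComponentIn (x := x)).interior_eq, ← h]
  exact mem_connectedComponentIn hyS

lemma lap_congr {k : ℕ} {f h : ESp k → ℝ} {x : ESp k} (hfh : f =ᶠ[nhds x] h) :
    lap f x = lap h x := by
  refine Finset.sum_congr rfl fun i _ => ?_
  have : (fun y => fderiv ℝ f y (EuclideanSpace.single i 1)) =ᶠ[nhds x]
      fun y => fderiv ℝ h y (EuclideanSpace.single i 1) :=
    (hfh.fderiv (𝕜 := ℝ)).mono fun y hy => by simp only [hy]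
  rw [this.fderiv_eq]

lemma lap_const_mul {k : ℕ} (a : ℝ) (f : ESp k → ℝ) (x : ESp k) :
    lap (fun y => a * f y) x = a * lap f x := by
  simp only [lap, Finset.mul_sum]
  refine Finset.sum_congr rfl fun i _ => ?_
  have h : ∀ (u : ESp k → ℝ) y v, fderiv ℝ (fun y => a * u y) y v = a * fderiv ℝ u y v := by
    intro u y v
    have := congrFun (fderiv_const_smul_field (𝕜 := ℝ) (f := u) a) y
    exact congrArg (fun L : ESp k →L[ℝ] ℝ => L v) this
  simp only [h]

/-- A continuous function has constant sign on a preconnected set where it does not vanish. -/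
lemma exists_sign_of_isPreconnected {X : Type*} [TopologicalSpace X] {N : Set X}
    (hN : IsPreconnected N) {f : X → ℝ} (hf : ContinuousOn f N) (hne : ∀ x ∈ N, f x ≠ 0) :
    ∃ σ : ℝ, ∀ x ∈ N, 0 < σ * f x := by
  by_cases h : ∀ x ∈ N, 0 < f x
  · exact ⟨1, fun x hx => by simpa using h x hx⟩
  · push Not at h
    obtain ⟨y, hy, hy0⟩ := h
    refine ⟨-1, fun x hx => ?_⟩
    by_contra! hx0
    obtain ⟨z, hz, hz0⟩ := hN.intermediate_value hy hx hf ⟨hy0, by linarith⟩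
    exact hne z hz hz0

/-- (Pleijel / Proposition 4.1.) A first nonzero Neumann eigenfunction of a
bounded simply connected planar domain with smooth boundary has no closed nodal curve:
the closure of every nodal domain meets the boundary. -/
theorem stmt7 (Ω : Set (ESp 2)) (hopen : IsOpen Ω) (hbdd : Bornology.IsBounded Ω)
    (hsc : SimplyConnectedSpace ↥Ω)
    (hsmooth : ∃ f : ESp 2 → ℝ, ContDiff ℝ (⊤ : ℕ∞) f ∧ Ω = f ⁻¹' (Set.Iio 0) ∧
      ∀ x ∈ frontier Ω, fderiv ℝ f x ≠ 0)
    (hμpos : 0 < neuEig2 Ω)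
    (ψ : ESp 2 → ℝ) (hψ : IsNeuEigenfun2 Ω ψ) :
    ∀ x ∈ Ω, ψ x ≠ 0 →
      (closure (connectedComponentIn {y ∈ Ω | ψ y ≠ 0} x) ∩ frontier Ω).Nonempty := by
  intro x hxΩ hx
  obtain ⟨-, hreg, hpde, -⟩ := hψ
  by_contra hempty
  set S := {y ∈ Ω | ψ y ≠ 0} with hSdef
  set N := connectedComponentIn S x with hNdef
  have hψc : ContinuousOn ψ Ω := hreg.continuousOn.mono subset_closure
  have hS : IsOpen S := hψc.isOpen_inter_preimage hopen isOpen_compl_singleton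
  have hN : IsOpen N := hS.connectedComponentIn
  have hNS : N ⊆ S := connectedComponentIn_subset S x
  have hNΩ : N ⊆ Ω := fun y hy => (hNS hy).1
  have hNne : N.Nonempty := ⟨x, mem_connectedComponentIn ⟨hxΩ, hx⟩⟩
  have hclN : closure N ⊆ Ω := by
    intro y hy
    by_contra hyΩ
    exact hempty ⟨y, hy, closure_mono hNΩ hy, by rwa [hopen.interior_eq]⟩
  obtain ⟨σ, hσ⟩ := exists_sign_of_isPreconnected isPreconnected_connectedComponentIn
    (hψc.mono hNΩ) fun y hy => (hNS hy).2
  obtain ⟨χ, hχ, hχc, hχΩ, hχ1⟩ := exists_smooth_cutoff hopen hbdd isClosed_closure hclN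
  have hχN : ∀ y ∈ N, χ =ᶠ[nhds y] 1 := fun y hy =>
    eventually_nhdsSet_iff_forall.mp hχ1 y (subset_closure hy)
  have hφ : ContDiff ℝ 2 fun y => σ * (χ y * ψ y) := by
    refine contDiff_const.mul (contDiff_iff_contDiffAt.mpr fun y => ?_)
    by_cases hy : y ∈ Ω
    · exact (contDiff_infty.mp hχ 2).contDiffAt.mul
        (hreg.contDiffAt (mem_of_superset (hopen.mem_nhds hy) subset_closure))
    · have : (fun y => χ y * ψ y) =ᶠ[nhds y] fun _ => 0 :=
        (notMem_tsupport_iff_eventuallyEq.mp fun h => hy (hχΩ h)).mono fun z hz => by simp [hz]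
      exact contDiffAt_const.congr_of_eventuallyEq this
  obtain ⟨f, hf, hfc, hfΩ, hfneg⟩ := exists_energy_neg_of_nodal_domain hbdd hμpos hN hNne hclN hφ
    (fun y hy => by
      have : χ y = 1 := (hχN y hy).self_of_nhds
      simpa [this] using hσ y hy)
    (fun y hy => by
      simp [eq_zero_of_mem_frontier_nodal_domain hS (hclN hy.1) hy])
    (fun y hy => by
      have : (fun z => χ z * ψ z) =ᶠ[nhds y] ψ := (hχN y hy).mono fun z hz => by simp [hz]
      have h1 : χ y = 1 := (hχN y hy).self_of_nhds
      rw [lap_const_mul, lap_congr this, h1]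
      linear_combination σ * hpde y (hNΩ hy))
    (hχ.of_le (by exact_mod_cast le_top)) hχc hχΩ (fun y hy => (hχN y hy).self_of_nhds)
  obtain ⟨g, hg, hgc, hgΩ, hgneg⟩ := exists_contDiff_energy_neg hopen hbdd hμpos hf hfc hfΩ hfneg
  obtain ⟨v, hv, hmean, hvneg⟩ :=
    exists_mean_zero_energy_neg hopen ⟨x, hxΩ⟩ hbdd hμpos hg hgc hgΩ hgneg
  exact not_energy_neg_of_mean_zero hbdd hv hmean hμpos hvneg
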